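/- arXiv:2411.05701 — 7 statements merged into one kernel-verified Lean document; each statement's English description precedes it below -/
import Mathlib

section
/- Smith short exact sequence for permutation modules: let p be a prime, let the cyclic group G of order p with generator g act on a type X, and let M = X →₀ 𝔽_p be the associated permutation module, with η : M → M the 𝔽_p-linear map η(v) = v − g•v (where g•v is the map induced on finitely supported functions by the action of g on X). Then for every i with 1 ≤ i ≤ p−1: (a) ker(η^i) = range(η^{p−i}) + Supp_G, where Supp_G ⊆ M is the submodule of functions supported on the set of G-fixed points of X; and (b) the sum is direct, i.e., range(η^{p−i}) ∩ Supp_G = 0. Equivalently, 0 → range(η^{p−i}) ⊕ Supp_G → M → range(η^i) → 0 (inclusion followed by η^i) is a short exact sequence. -/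
open Finset

/-- In characteristic `p`, `(1 - t) ^ (p - 1) = 1 + t + ⋯ + t ^ (p - 1)`. -/
theorem one_sub_pow_prime_sub_one {p : ℕ} [hp : Fact p.Prime] {A : Type*} [Ring A]
    [Algebra (ZMod p) A] (t : A) : (1 - t) ^ (p - 1) = ∑ k ∈ range p, t ^ k := by
  have key : (1 - Polynomial.X : Polynomial (ZMod p)) ^ (p - 1)
      = ∑ k ∈ range p, Polynomial.X ^ k := by
    have hne : (1 - Polynomial.X : Polynomial (ZMod p)) ≠ 0 :=
      sub_ne_zero.mpr (Polynomial.X_ne_C 1).symm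
    apply mul_right_cancel₀ hne
    rw [geom_sum_mul_neg, ← pow_succ, Nat.sub_add_cancel hp.out.one_le, sub_pow_char, one_pow]
  simpa using congrArg (Polynomial.aeval t) key

/-- An element of order `p` acts freely on the points that it does not fix. -/
theorem ofAdd_one_smul_eq_of_ofAdd_smul_eq {p : ℕ} [Fact p.Prime] {X : Type*}
    [MulAction (Multiplicative (ZMod p)) X] {x : X} {b : ZMod p} (hb : b ≠ 0)
    (h : Multiplicative.ofAdd b • x = x) : Multiplicative.ofAdd (1 : ZMod p) • x = x := by
  have hmem : Multiplicative.ofAdd b ∈ MulAction.stabilizer (Multiplicative (ZMod p)) x := h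
  have hpow := pow_mem hmem (b⁻¹).val
  have : Multiplicative.ofAdd b ^ (b⁻¹).val = Multiplicative.ofAdd (1 : ZMod p) := by
    rw [← ofAdd_nsmul, nsmul_eq_mul, ZMod.natCast_zmod_val, inv_mul_cancel₀ hb]
  rwa [this] at hpow

theorem lmapDomain_smul_apply {G R X : Type*} [Group G] [MulAction G X] [Semiring R] (g : G)
    (v : X →₀ R) (x : X) :
    Finsupp.lmapDomain R R (fun x : X => g • x) v x = v (g⁻¹ • x) := by
  have h := Finsupp.mapDomain_apply (MulAction.injective g) v (g⁻¹ • x)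
  rwa [smul_inv_smul] at h

theorem lmapDomain_smul_pow_apply {G R X : Type*} [Group G] [MulAction G X] [Semiring R] (g : G)
    (k : ℕ) (v : X →₀ R) (x : X) :
    (Finsupp.lmapDomain R R (fun x : X => g • x) ^ k) v x = v ((g ^ k)⁻¹ • x) := by
  induction k generalizing x with
  | zero => simp
  | succ k ih =>
    rw [pow_succ', Module.End.mul_apply, lmapDomain_smul_apply, ih, smul_smul, pow_succ',
      mul_inv_rev]

theorem sum_lmapDomain_smul_pow_apply {p : ℕ} [hp : Fact p.Prime] {R X : Type*} [Semiring R]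
    [MulAction (Multiplicative (ZMod p)) X] (v : X →₀ R) (x : X) :
    (∑ k ∈ range p,
      Finsupp.lmapDomain R R (fun x : X => Multiplicative.ofAdd (1 : ZMod p) • x) ^ k) v x
      = ∑ a : ZMod p, v (Multiplicative.ofAdd a • x) := by
  rw [LinearMap.sum_apply, Finsupp.finsetSum_apply]
  simp_rw [lmapDomain_smul_pow_apply, ← ofAdd_nsmul, ← ofAdd_neg, nsmul_one]
  refine sum_bij' (fun k _ => -(k : ZMod p)) (fun a _ => (-a).val) ?_ ?_ ?_ ?_ ?_
  · simp
  · simp [ZMod.val_lt]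
  · intro k hk
    simpa using ZMod.val_cast_of_lt (mem_range.mp hk)
  · simp
  · simp

/-- An invariant function vanishing at the fixed points is a sum of translates. -/
theorem exists_sum_ofAdd_smul_eq {p : ℕ} [Fact p.Prime] {R X : Type*} [Semiring R]
    [MulAction (Multiplicative (ZMod p)) X] (u : X →₀ R)
    (hinv : ∀ (a : Multiplicative (ZMod p)) x, u (a • x) = u x)
    (hfix : ∀ x, Multiplicative.ofAdd (1 : ZMod p) • x = x → u x = 0) :
    ∃ w : X →₀ R, ∀ x, ∑ a : ZMod p, w (Multiplicative.ofAdd a • x) = u x := by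
  classical
  let s := MulAction.orbitRel (Multiplicative (ZMod p)) X
  let rep : X → X := fun x => (Quotient.mk s x).out
  have hrep (a : Multiplicative (ZMod p)) (x : X) : rep (a • x) = rep x :=
    congrArg Quotient.out (Quotient.sound (s := s) (MulAction.mem_orbit x a))
  refine ⟨u.filter fun x => rep x = x, fun x => ?_⟩
  simp_rw [Finsupp.filter_apply, hinv, hrep]
  by_cases hx : Multiplicative.ofAdd (1 : ZMod p) • x = x
  · simp [hfix x hx]
  obtain ⟨b, hb⟩ : ∃ b : Multiplicative (ZMod p), b • x = rep x :=
    Quotient.exact (s := s) (Quotient.out_eq (Quotient.mk s x))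
  rw [sum_eq_single_of_mem (Multiplicative.toAdd b) (mem_univ _), if_pos (by simp [hb])]
  intro c _ hc
  refine if_neg fun h => hx (ofAdd_one_smul_eq_of_ofAdd_smul_eq
    (sub_ne_zero.mpr hc) (?_ : Multiplicative.ofAdd (c - Multiplicative.toAdd b) • x = x))
  rw [sub_eq_neg_add, ofAdd_add, mul_smul, ← h, ← hb, ofAdd_neg, ofAdd_toAdd, inv_smul_smul]

/-- If `η` kills `S`, `range η` meets `S` trivially, `η ^ p = 0`, and the kernel of `η` is contained
in `range (η ^ (p - 1)) ⊔ S`, then `ker (η ^ i) = range (η ^ (p - i)) ⊔ S` for `0 < i < p`. -/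
theorem LinearMap.ker_pow_eq_range_pow_sup {R M : Type*} [Ring R] [AddCommGroup M] [Module R M]
    {η : Module.End R M} {S : Submodule R M} {p : ℕ} (hS : S ≤ LinearMap.ker η)
    (hdisj : LinearMap.range η ⊓ S = ⊥) (hpow : η ^ p = 0)
    (hker : LinearMap.ker η ≤ LinearMap.range (η ^ (p - 1)) ⊔ S) {i : ℕ} (hi : 1 ≤ i)
    (hip : i < p) : LinearMap.ker (η ^ i) = LinearMap.range (η ^ (p - i)) ⊔ S := by
  apply le_antisymm
  · induction i, hi using Nat.le_induction with
    | base => simpa using hker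
    | succ i hi ih =>
      intro v hv
      have hηv : η v ∈ LinearMap.ker (η ^ i) := by
        rwa [LinearMap.mem_ker, ← Module.End.mul_apply, ← pow_succ]
      obtain ⟨_, ⟨w, rfl⟩, s, hs, hsum⟩ := Submodule.mem_sup.mp (ih (by omega) hηv)
      have hexp : η ^ (p - i) = η * η ^ (p - (i + 1)) := by
        rw [← pow_succ']; congr 1; omega
      rw [hexp, Module.End.mul_apply] at hsum
      have hs0 : s ∈ LinearMap.range η ⊓ S :=
        ⟨⟨v - (η ^ (p - (i + 1))) w, by rw [map_sub, ← hsum, add_sub_cancel_left]⟩, hs⟩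
      rw [hdisj, Submodule.mem_bot] at hs0
      have hsub : v - (η ^ (p - (i + 1))) w ∈ LinearMap.ker η := by
        rw [LinearMap.mem_ker, map_sub, ← hsum, hs0, add_zero, sub_self]
      have hle : LinearMap.range (η ^ (p - 1)) ≤ LinearMap.range (η ^ (p - (i + 1))) := by
        rw [show p - 1 = (p - (i + 1)) + i by omega, pow_add]
        exact LinearMap.range_comp_le_range _ _
      rw [← sub_add_cancel v ((η ^ (p - (i + 1))) w)]
      exact add_mem (sup_le_sup_right hle S (hker hsub))
        (Submodule.mem_sup_left (LinearMap.mem_range_self _ w))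
  · refine sup_le ?_ fun s hs => ?_
    · rintro _ ⟨w, rfl⟩
      rw [LinearMap.mem_ker, ← Module.End.mul_apply, ← pow_add, Nat.add_sub_cancel' hip.le, hpow,
        LinearMap.zero_apply]
    · rw [LinearMap.mem_ker, ← Nat.sub_add_cancel hi, pow_succ, Module.End.mul_apply,
        LinearMap.mem_ker.mp (hS hs), map_zero]


/-- Smith short exact sequence for permutation modules: let `p` be a prime, let the
cyclic group `G` of order `p` with generator `g` act on a type `X`, and let
`M = X →₀ 𝔽_p` be the associated permutation module, with `η : M → M` the
`𝔽_p`-linear map `η v = v - g • v` (where `g • v` is induced on finitely supported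
functions by the action of `g` on `X`, via `Finsupp.lmapDomain`). Then for every
`i` with `1 ≤ i ≤ p - 1`: (a) `ker (η^i) = range (η^(p-i)) + Supp_G`, where
`Supp_G` is the submodule of functions supported on the `G`-fixed points of `X`;
and (b) the sum is direct: `range (η^(p-i)) ∩ Supp_G = 0`. -/
theorem smith_short_exact_sequence (p : ℕ) (hp : p.Prime) (X : Type*)
    [MulAction (Multiplicative (ZMod p)) X]
    (g : Multiplicative (ZMod p))
    (hg : g = Multiplicative.ofAdd (1 : ZMod p))
    (η : (X →₀ ZMod p) →ₗ[ZMod p] (X →₀ ZMod p))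
    (hη : η = LinearMap.id - Finsupp.lmapDomain (ZMod p) (ZMod p) (fun x : X => g • x))
    (SuppG : Submodule (ZMod p) (X →₀ ZMod p))
    (hSuppG : SuppG = Finsupp.supported (ZMod p) (ZMod p) {x : X | g • x = x})
    (i : ℕ) (hi1 : 1 ≤ i) (hi2 : i ≤ p - 1) :
    LinearMap.ker (η ^ i) = LinearMap.range (η ^ (p - i)) ⊔ SuppG ∧
      LinearMap.range (η ^ (p - i)) ⊓ SuppG = ⊥ := by
  have : Fact p.Prime := ⟨hp⟩
  subst hg hSuppG
  set g : Multiplicative (ZMod p) := Multiplicative.ofAdd 1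
  have hip : i < p := by have := hp.one_lt; omega
  have hη_apply (v : X →₀ ZMod p) (x : X) : η v x = v x - v (g⁻¹ • x) := by
    rw [hη, LinearMap.sub_apply, Finsupp.sub_apply, lmapDomain_smul_apply, LinearMap.id_apply]
  have hfix {x : X} (hx : g • x = x) : g⁻¹ • x = x := inv_smul_eq_iff.mpr hx.symm
  have hnorm : η ^ (p - 1)
      = ∑ k ∈ range p, Finsupp.lmapDomain (ZMod p) (ZMod p) (fun x : X => g • x) ^ k := by
    rw [hη]; exact one_sub_pow_prime_sub_one (A := Module.End (ZMod p) (X →₀ ZMod p)) _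
  have hker_inv {v : X →₀ ZMod p} (hv : η v = 0) (a : Multiplicative (ZMod p)) (x : X) :
      v (a • x) = v x := by
    have hstep (y : X) : v (g • y) = v y := by
      have h := hη_apply v (g • y)
      rw [hv, inv_smul_smul] at h
      exact sub_eq_zero.mp h.symm
    have hpow (k : ℕ) : v (g ^ k • x) = v x := by
      induction k with
      | zero => simp
      | succ k ih => rw [pow_succ', mul_smul, hstep, ih]
    rw [← hpow (Multiplicative.toAdd a).val, ← ofAdd_nsmul, nsmul_one, ZMod.natCast_zmod_val,
      ofAdd_toAdd]
  have hS : Finsupp.supported (ZMod p) (ZMod p) {x : X | g • x = x} ≤ LinearMap.ker η := by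
    intro s hs
    rw [Finsupp.mem_supported'] at hs
    rw [LinearMap.mem_ker]
    ext x
    rw [hη_apply, Finsupp.zero_apply]
    by_cases hx : g • x = x
    · rw [hfix hx, sub_self]
    · have hx' : ¬ g • g⁻¹ • x = g⁻¹ • x := fun h => hx <| by
        rw [smul_inv_smul] at h
        exact (eq_inv_smul_iff.mp h)
      rw [hs x hx, hs _ hx', sub_self]
  have hdisj : LinearMap.range η ⊓ Finsupp.supported (ZMod p) (ZMod p) {x : X | g • x = x} = ⊥ := by
    rw [eq_bot_iff]
    rintro _ ⟨⟨v, rfl⟩, hv⟩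
    have hv := (Finsupp.mem_supported' _ _).mp hv
    rw [Submodule.mem_bot]
    ext x
    by_cases hx : g • x = x
    · rw [hη_apply, hfix hx, sub_self, Finsupp.zero_apply]
    · exact hv x hx
  have hker : LinearMap.ker η ≤ LinearMap.range (η ^ (p - 1))
      ⊔ Finsupp.supported (ZMod p) (ZMod p) {x : X | g • x = x} := by
    classical
    intro v hv
    have hs : v.filter (fun x => g • x = x)
        ∈ Finsupp.supported (ZMod p) (ZMod p) {x : X | g • x = x} :=
      (Finsupp.mem_supported' _ _).mpr fun x hx => Finsupp.filter_apply_neg _ _ hx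
    have hu : η (v.filter fun x => ¬ g • x = x) = 0 := by
      have h := congrArg η (Finsupp.filter_add_filter_not v fun x => g • x = x)
      rwa [map_add, LinearMap.mem_ker.mp (hS hs), zero_add, LinearMap.mem_ker.mp hv] at h
    obtain ⟨w, hw⟩ := exists_sum_ofAdd_smul_eq _ (hker_inv hu)
      fun x hx => Finsupp.filter_apply_neg _ _ (not_not.mpr hx)
    rw [← Finsupp.filter_add_filter_not v fun x => g • x = x, add_comm]
    refine Submodule.add_mem_sup ⟨w, ?_⟩ hs
    ext x
    rw [hnorm, sum_lmapDomain_smul_pow_apply, hw]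
  have hpow : η ^ p = 0 := by
    rw [← pow_sub_one_mul hp.ne_zero η, hnorm, hη]
    refine (geom_sum_mul_neg (R := Module.End (ZMod p) (X →₀ ZMod p)) _ p).trans
      (sub_eq_zero.mpr (Eq.symm ?_))
    refine LinearMap.ext fun v => Finsupp.ext fun x => ?_
    rw [lmapDomain_smul_pow_apply, ← ofAdd_nsmul, nsmul_one, CharP.cast_eq_zero, ofAdd_zero,
      inv_one, one_smul, Module.End.one_apply]
  refine ⟨LinearMap.ker_pow_eq_range_pow_sup hS hdisj hpow hker hi1 hip, ?_⟩
  rw [eq_bot_iff, ← hdisj]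
  refine inf_le_inf_right _ ?_
  rw [show p - i = (p - i - 1) + 1 by omega, pow_succ']
  exact LinearMap.range_comp_le_range _ _
end

section
/- Let Σ_k act on ℝ^N × ℝ^k by permuting the last k coordinates, and let F be the set of points fixed by some non-identity permutation. Then for every σ ∈ Σ_k and every point q in the complement of F: if σ • q lies in the connected component of q inside the complement of F, then σ is the identity. In particular, for each connected component U of the complement of F, one has U ∩ (σ • U) ≠ ∅ if and only if σ = id. -/
/-- Two continuous functions that agree nowhere on a preconnected set keep their order on it. -/
lemma IsPreconnected.lt_of_lt_of_forall_ne {X α : Type*} [TopologicalSpace X] [LinearOrder α]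
    [TopologicalSpace α] [OrderClosedTopology α] {s : Set X} (hs : IsPreconnected s) {f g : X → α}
    (hf : ContinuousOn f s) (hg : ContinuousOn g s) (hne : ∀ x ∈ s, f x ≠ g x) {a b : X}
    (ha : a ∈ s) (hb : b ∈ s) (hab : f a < g a) : f b < g b := by
  by_contra! hle
  obtain ⟨c, hc, hfg⟩ := hs.intermediate_value₂ ha hb hf hg hab.le hle
  exact hne c hc hfg

/-- A permutation of a finite type preserving the strict order induced by `x` does not
increase `x`. -/
lemma Equiv.Perm.apply_le_of_forall_lt_imp_lt {ι α : Type*} [Finite ι] [LinearOrder α]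
    (τ : Equiv.Perm ι) {x : ι → α} (hτ : ∀ i j, x i < x j → x (τ i) < x (τ j)) (i : ι) :
    x (τ i) ≤ x i := by
  by_contra! hi
  have hmono : StrictMono fun n : ℕ => x ((τ ^ n) i) := by
    refine strictMono_nat_of_lt_succ fun n => ?_
    induction n with
    | zero => simpa using hi
    | succ n ih =>
      rw [pow_succ' τ n, pow_succ' τ (n + 1)]
      exact hτ _ _ ih
  simpa [pow_orderOf_eq_one] using hmono (orderOf_pos τ)

/-- A permutation of a finite type preserving the strict order induced by an injective function
is the identity. -/
lemma Equiv.Perm.eq_one_of_forall_lt_imp_lt {ι α : Type*} [Finite ι] [LinearOrder α]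
    (τ : Equiv.Perm ι) {x : ι → α} (hx : Function.Injective x)
    (hτ : ∀ i j, x i < x j → x (τ i) < x (τ j)) : τ = 1 := by
  ext1 i
  exact hx <| le_antisymm (τ.apply_le_of_forall_lt_imp_lt hτ i)
    (τ.apply_le_of_forall_lt_imp_lt (x := OrderDual.toDual ∘ x) (fun i j => hτ j i) i)

/-- Let `Σ_k` act on `ℝ^N × ℝ^k` by permuting the last `k` coordinates
(`σ • (a, x) = (a, x ∘ σ⁻¹)`), and let `F` be the set of points fixed by some
non-identity permutation, i.e. `F = {(a, x) | ∃ i ≠ j, x i = x j}`. Then for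
every `σ ∈ Σ_k` and every point `q ∉ F`: if `σ • q` lies in the connected
component of `q` inside the complement of `F`, then `σ` is the identity. -/
theorem perm_moves_chamber (k N : ℕ)
    (F : Set ((Fin N → ℝ) × (Fin k → ℝ)))
    (hF : F = {q | ∃ i j, i ≠ j ∧ q.2 i = q.2 j})
    (σ : Equiv.Perm (Fin k))
    (q : (Fin N → ℝ) × (Fin k → ℝ)) (hq : q ∉ F)
    (h : (q.1, q.2 ∘ ⇑σ⁻¹) ∈ connectedComponentIn Fᶜ q) :
    σ = 1 := by
  subst hF
  have hx : Function.Injective q.2 := fun i j hij => by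
    by_contra hne
    exact hq ⟨i, j, hne, hij⟩
  refine inv_eq_one.mp (σ⁻¹.eq_one_of_forall_lt_imp_lt hx fun i j hij => ?_)
  have hne : i ≠ j := fun hij' => hij.ne (congrArg q.2 hij')
  exact isPreconnected_connectedComponentIn.lt_of_lt_of_forall_ne
    (f := fun p : (Fin N → ℝ) × (Fin k → ℝ) => p.2 i) (g := fun p => p.2 j)
    (by fun_prop) (by fun_prop)
    (fun p hp hpij => absurd ⟨i, j, hne, hpij⟩ (connectedComponentIn_subset _ q hp))
    (mem_connectedComponentIn hq) h hij
end

section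
/- Let i ≠ j in Fin k and let τ : (Fin k → ℝ) → (Fin k → ℝ) be the transposition of the i-th and j-th coordinates (precomposition with Equiv.swap i j). If C ⊆ (Fin k → ℝ) is a preconnected set and there exists y with y ∈ C and τ(y) ∈ C (equivalently C ∩ τ(C) ≠ ∅), then C contains a point z with z i = z j, i.e., a point fixed by the transposition (i j). -/
/-- Let `i ≠ j` in `Fin k` and let `τ` be the transposition of the `i`-th and
`j`-th coordinates of `ℝ^k` (precomposition with `Equiv.swap i j`). If
`C ⊆ ℝ^k` is a preconnected set containing some `y` together with `τ y`, then
`C` contains a point `z` with `z i = z j`, i.e. a point fixed by the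
transposition `(i j)`. -/
theorem preconnected_swap_invariant_meets_wall (k : ℕ) (i j : Fin k) (hij : i ≠ j)
    (C : Set (Fin k → ℝ)) (hC : IsPreconnected C)
    (y : Fin k → ℝ) (hy : y ∈ C) (hy' : y ∘ ⇑(Equiv.swap i j) ∈ C) :
    ∃ z ∈ C, z i = z j := by
  have hi : Continuous fun z : Fin k → ℝ => z i := continuous_apply i
  have hj : Continuous fun z : Fin k → ℝ => z j := continuous_apply j
  rcases le_total (y i) (y j) with h | h
  · exact hC.intermediate_value₂ hy hy' hi.continuousOn hj.continuousOn h (by simpa using h)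
  · exact hC.intermediate_value₂ hy' hy hi.continuousOn hj.continuousOn (by simpa using h) h
end

section
/- Let Σ_k act on ℝ^N × ℝ^k by permuting the last k coordinates, and let F be the set of points fixed by some non-identity permutation. If C ⊆ ℝ^N × ℝ^k is a nonempty connected set and σ • C = C for some non-identity permutation σ ∈ Σ_k, then C meets F; that is, C contains a point (a, x) with x i = x j for some i ≠ j. -/
/-- A permutation of a finite type that preserves the strict order pulled back along an injective
map to a linear order is the identity. -/
theorem Equiv.Perm.eq_one_of_lt_imp_lt {ι α : Type*} [Finite ι] [LinearOrder α] {x : ι → α}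
    (hx : Function.Injective x) {τ : Equiv.Perm ι}
    (hτ : ∀ i j, x i < x j → x (τ i) < x (τ j)) : τ = 1 := by
  by_contra hne
  have hmoved : {i | τ i ≠ i}.Nonempty := by
    by_contra hempty
    refine hne (Equiv.ext fun i => ?_)
    by_contra hi
    exact hempty ⟨i, hi⟩
  obtain ⟨i, hi, hmax⟩ := Set.exists_max_image _ x (Set.toFinite _) hmoved
  have himage : x (τ i) < x i :=
    (hmax (τ i) fun h => hi (τ.injective h)).lt_of_ne fun h => hi (hx h)
  have hpre : τ.symm i ≠ i := fun h => hi ((τ.symm_apply_eq.mp h).symm)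
  have hlt : x (τ.symm i) < x i :=
    (hmax (τ.symm i) fun h => hpre ((τ.apply_symm_apply i).symm.trans h).symm).lt_of_ne
      fun h => hpre (hx h)
  have := hτ _ _ hlt
  rw [τ.apply_symm_apply] at this
  exact this.asymm himage

/-- Let `Σ_k` act on `ℝ^N × ℝ^k` by permuting the last `k` coordinates
(`σ • (a, x) = (a, x ∘ σ⁻¹)`), and let `F` be the set of points fixed by some
non-identity permutation, i.e. `F = {(a, x) | ∃ i ≠ j, x i = x j}`. If `C` is a
nonempty connected subset of `ℝ^N × ℝ^k` with `σ • C = C` for some non-identity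
permutation `σ`, then `C` meets `F`. -/
theorem invariant_connected_meets_fixed (k N : ℕ)
    (F : Set ((Fin N → ℝ) × (Fin k → ℝ)))
    (hF : F = {q | ∃ i j, i ≠ j ∧ q.2 i = q.2 j})
    (C : Set ((Fin N → ℝ) × (Fin k → ℝ)))
    (hC : IsConnected C)
    (σ : Equiv.Perm (Fin k)) (hσ : σ ≠ 1)
    (hinv : (fun q : (Fin N → ℝ) × (Fin k → ℝ) => (q.1, q.2 ∘ ⇑σ⁻¹)) '' C = C) :
    (C ∩ F).Nonempty := by
  subst hF
  by_contra hdisj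
  have hinj : ∀ q ∈ C, Function.Injective q.2 := fun q hq i j hij => by
    by_contra hne
    exact hdisj ⟨q, hq, i, j, hne, hij⟩
  have hlt : ∀ p ∈ C, ∀ q ∈ C, ∀ i j, p.2 i < p.2 j → q.2 i < q.2 j := by
    intro p hp q hq i j hij
    by_contra! hji
    obtain ⟨r, hr, hreq⟩ := hC.isPreconnected.intermediate_value₂ hp hq
      (f := fun q => q.2 i) (g := fun q => q.2 j) (by fun_prop) (by fun_prop) hij.le hji
    exact hij.ne (congrArg p.2 (hinj r hr hreq))
  obtain ⟨p, hp⟩ := hC.nonempty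
  have hσp : (p.1, p.2 ∘ ⇑σ⁻¹) ∈ C := hinv ▸ Set.mem_image_of_mem _ hp
  exact hσ (inv_eq_one.mp (Equiv.Perm.eq_one_of_lt_imp_lt (hinj p hp) (hlt p hp _ hσp)))
end

section
/- Smoothness of the complex triple point space of the perturbed Q₂ singularity: fix s ∈ ℂ with s ≠ 0 and define h : ℂ⁵ → ℂ⁴ in coordinates (x, y, z₁, z₂, z₃) by h = (x + y(z₁ + z₂), z₁² + z₁z₂ + z₂² + y² − s, y, z₁ + z₂ + z₃). Then at every point q with h(q) = 0, the (complex Fréchet) derivative of h at q is a surjective linear map ℂ⁵ → ℂ⁴; i.e., 0 is a regular value of h and the zero set D³(Q_{2,s}) is smooth. -/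
/-- The derivative of the defining map of the triple point space, in coordinates. -/
theorem fderiv_triplePointMap_apply (s x y z₁ z₂ z₃ a b c₁ c₂ c₃ : ℂ) :
    fderiv ℂ (fun p : ℂ × ℂ × ℂ × ℂ × ℂ =>
      (p.1 + p.2.1 * (p.2.2.1 + p.2.2.2.1),
        p.2.2.1 ^ 2 + p.2.2.1 * p.2.2.2.1 + p.2.2.2.1 ^ 2 + p.2.1 ^ 2 - s,
        p.2.1, p.2.2.1 + p.2.2.2.1 + p.2.2.2.2)) (x, y, z₁, z₂, z₃) (a, b, c₁, c₂, c₃) =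
      (a + b * (z₁ + z₂) + y * (c₁ + c₂),
        (2 * z₁ + z₂) * c₁ + (z₁ + 2 * z₂) * c₂ + 2 * y * b, b, c₁ + c₂ + c₃) := by
  set q : ℂ × ℂ × ℂ × ℂ × ℂ := (x, y, z₁, z₂, z₃) with hq
  have h₁ := hasFDerivAt_fst (𝕜 := ℂ) (p := q)
  have t₁ := hasFDerivAt_snd (𝕜 := ℂ) (p := q)
  have h₂ := t₁.fst
  have h₃ := t₁.snd.fst
  have h₄ := t₁.snd.snd.fst
  have h₅ := t₁.snd.snd.snd
  have H := (h₁.add (h₂.mul (h₃.add h₄))).prodMk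
    ((((((h₃.pow 2).add (h₃.mul h₄)).add (h₄.pow 2)).add (h₂.pow 2)).sub_const s).prodMk
      (h₂.prodMk ((h₃.add h₄).add h₅)))
  refine (congrArg (fun L => L (a, b, c₁, c₂, c₃)) H.fderiv).trans ?_
  simp [hq]
  constructor <;> ring

/-- Smoothness of the complex triple point space of the perturbed `Q₂`
singularity: fix `s ∈ ℂ` with `s ≠ 0` and define `h : ℂ⁵ → ℂ⁴` in coordinates
`(x, y, z₁, z₂, z₃)` by
`h = (x + y(z₁ + z₂), z₁² + z₁z₂ + z₂² + y² − s, y, z₁ + z₂ + z₃)`.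
Then at every point `q` with `h q = 0`, the complex Fréchet derivative of `h` at
`q` is a surjective linear map `ℂ⁵ → ℂ⁴`; i.e. `0` is a regular value of `h` and
the zero set `D³(Q_{2,s})` is smooth. -/
theorem triple_point_space_Q2_smooth (s : ℂ) (hs : s ≠ 0)
    (h : ℂ × ℂ × ℂ × ℂ × ℂ → ℂ × ℂ × ℂ × ℂ)
    (hh : ∀ x y z₁ z₂ z₃ : ℂ,
      h (x, y, z₁, z₂, z₃) =
        (x + y * (z₁ + z₂), z₁ ^ 2 + z₁ * z₂ + z₂ ^ 2 + y ^ 2 - s, y, z₁ + z₂ + z₃))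
    (q : ℂ × ℂ × ℂ × ℂ × ℂ) (hq : h q = 0) :
    Function.Surjective (fderiv ℂ h q) := by
  have hf : h = fun p => (p.1 + p.2.1 * (p.2.2.1 + p.2.2.2.1),
      p.2.2.1 ^ 2 + p.2.2.1 * p.2.2.2.1 + p.2.2.2.1 ^ 2 + p.2.1 ^ 2 - s,
      p.2.1, p.2.2.1 + p.2.2.2.1 + p.2.2.2.2) :=
    funext fun ⟨x, y, z₁, z₂, z₃⟩ => hh x y z₁ z₂ z₃
  obtain ⟨x, y, z₁, z₂, z₃⟩ := q
  rw [hh] at hq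
  simp only [Prod.mk_eq_zero] at hq
  obtain ⟨-, hquad, rfl, -⟩ := hq
  rintro ⟨u, v, w, t⟩
  obtain ⟨c₁, c₂, hc⟩ : ∃ c₁ c₂ : ℂ, (2 * z₁ + z₂) * c₁ + (z₁ + 2 * z₂) * c₂ = v := by
    by_cases hA : 2 * z₁ + z₂ = 0
    · have hB : z₁ + 2 * z₂ ≠ 0 := fun hB => hs <| by
        linear_combination -hquad + z₁ / 2 * hA + z₂ / 2 * hB
      exact ⟨0, v / (z₁ + 2 * z₂), by rw [mul_zero, zero_add, mul_div_cancel₀ _ hB]⟩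
    · exact ⟨v / (2 * z₁ + z₂), 0, by rw [mul_zero, add_zero, mul_div_cancel₀ _ hA]⟩
  refine ⟨(u - w * (z₁ + z₂), w, c₁, c₂, t - c₁ - c₂), ?_⟩
  rw [hf, fderiv_triplePointMap_apply]
  refine Prod.ext ?_ (Prod.ext ?_ (Prod.ext rfl ?_))
  · ring
  · linear_combination hc
  · ring
end

section
/- The real double point space of the good real perturbation of Q₂ is a 2-sphere: for every real s > 0, the set {(x, y, z₁, z₂) ∈ ℝ⁴ : x + y(z₁ + z₂) = 0 and z₁² + z₁z₂ + z₂² + y² = s}, with the subspace topology, is homeomorphic to the unit 2-sphere S² ⊆ ℝ³. -/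
/-- The real double point space of the good real perturbation of `Q₂` is a
2-sphere: for every real `s > 0`, the set
`{(x, y, z₁, z₂) ∈ ℝ⁴ : x + y(z₁ + z₂) = 0 ∧ z₁² + z₁z₂ + z₂² + y² = s}`,
with the subspace topology, is homeomorphic to the unit 2-sphere `S² ⊆ ℝ³`. -/
theorem real_double_point_space_Q2_sphere (s : ℝ) (hs : 0 < s) :
    Nonempty
      (({q : ℝ × ℝ × ℝ × ℝ |
          q.1 + q.2.1 * (q.2.2.1 + q.2.2.2) = 0 ∧
          q.2.2.1 ^ 2 + q.2.2.1 * q.2.2.2 + q.2.2.2 ^ 2 + q.2.1 ^ 2 = s} :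
          Set (ℝ × ℝ × ℝ × ℝ)) ≃ₜ
        (Metric.sphere (0 : EuclideanSpace ℝ (Fin 3)) 1)) := by
  obtain ⟨r, hr, rfl⟩ : ∃ r : ℝ, 0 < r ∧ r ^ 2 = s :=
    ⟨√s, Real.sqrt_pos.2 hs, Real.sq_sqrt hs.le⟩
  obtain ⟨t, ht, ht2⟩ : ∃ t : ℝ, 0 < t ∧ t ^ 2 = 3 :=
    ⟨√3, by positivity, Real.sq_sqrt (by norm_num)⟩
  refine ⟨{
    toFun := fun q => ⟨!₂[q.1.2.1 / r, (q.1.2.2.1 + q.1.2.2.2 / 2) / r,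
      t * q.1.2.2.2 / (2 * r)], ?_⟩
    invFun := fun p => ⟨(-(r * p.1 0) * (r * p.1 1 + r * p.1 2 / t), r * p.1 0,
      r * p.1 1 - r * p.1 2 / t, 2 * r * p.1 2 / t), ?_⟩
    left_inv := ?_
    right_inv := ?_
    continuous_toFun := ?_
    continuous_invFun := ?_ }⟩
  · obtain ⟨⟨x, y, z₁, z₂⟩, -, h⟩ := q
    simp only at h
    rw [EuclideanSpace.sphere_zero_eq 1 zero_le_one]
    simp only [Set.mem_ofPred_eq, Fin.sum_univ_three, Matrix.cons_val]
    field_simp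
    linear_combination 4 * h + z₂ ^ 2 * ht2
  · obtain ⟨p, hp⟩ := p
    rw [EuclideanSpace.sphere_zero_eq 1 zero_le_one] at hp
    simp only [Set.mem_ofPred_eq, Fin.sum_univ_three] at hp
    refine ⟨by simp only; ring, ?_⟩
    simp only
    field_simp
    linear_combination t ^ 2 * hp - p 2 ^ 2 * ht2
  · rintro ⟨⟨x, y, z₁, z₂⟩, h, -⟩
    simp only at h
    simp only [Subtype.mk.injEq, Prod.mk.injEq, Matrix.cons_val]
    refine ⟨?_, ?_, ?_, ?_⟩ <;> field_simp
    · linear_combination -2 * h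
    · ring
  · rintro ⟨p, hp⟩
    ext i
    fin_cases i <;> simp <;> field_simp
    ring
  · fun_prop
  · fun_prop
end

section
/- The real triple point space of the good real perturbation of Q₂ is a circle: for every real s > 0, the set {(x, y, z₁, z₂, z₃) ∈ ℝ⁵ : x + y(z₁ + z₂) = 0, z₁² + z₁z₂ + z₂² + y² = s, y = 0, and z₁ + z₂ + z₃ = 0}, with the subspace topology, is homeomorphic to the unit circle S¹ ⊆ ℝ². -/
/-- The real triple point space of the good real perturbation of `Q₂` is a
circle: for every real `s > 0`, the set
`{(x, y, z₁, z₂, z₃) ∈ ℝ⁵ : x + y(z₁ + z₂) = 0, z₁² + z₁z₂ + z₂² + y² = s,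
y = 0, z₁ + z₂ + z₃ = 0}`, with the subspace topology, is homeomorphic to the
unit circle `S¹ ⊆ ℝ²`. -/
theorem real_triple_point_space_Q2_circle (s : ℝ) (hs : 0 < s) :
    Nonempty
      (({q : ℝ × ℝ × ℝ × ℝ × ℝ |
          q.1 + q.2.1 * (q.2.2.1 + q.2.2.2.1) = 0 ∧
          q.2.2.1 ^ 2 + q.2.2.1 * q.2.2.2.1 + q.2.2.2.1 ^ 2 + q.2.1 ^ 2 = s ∧
          q.2.1 = 0 ∧
          q.2.2.1 + q.2.2.2.1 + q.2.2.2.2 = 0} :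
          Set (ℝ × ℝ × ℝ × ℝ × ℝ)) ≃ₜ
        (Metric.sphere (0 : EuclideanSpace ℝ (Fin 2)) 1)) := by
  obtain ⟨r, hr, rfl⟩ : ∃ r : ℝ, 0 < r ∧ r ^ 2 = s :=
    ⟨√s, Real.sqrt_pos.2 hs, Real.sq_sqrt hs.le⟩
  obtain ⟨t, ht3⟩ : ∃ t : ℝ, t ^ 2 = 3 :=
    ⟨√3, Real.sq_sqrt (by norm_num)⟩
  have mem_circle (p : EuclideanSpace ℝ (Fin 2)) :
      p ∈ Metric.sphere (0 : EuclideanSpace ℝ (Fin 2)) 1 ↔ p 0 ^ 2 + p 1 ^ 2 = 1 := by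
    rw [mem_sphere_zero_iff_norm, ← sq_eq_sq₀ (norm_nonneg p) zero_le_one,
      EuclideanSpace.real_norm_sq_eq, Fin.sum_univ_two, one_pow]
  exact ⟨{
    toFun := fun q => ⟨!₂[t * (q.1.2.2.1 + q.1.2.2.2.1) / (2 * r),
        (q.1.2.2.1 - q.1.2.2.2.1) / (2 * r)], by
      obtain ⟨⟨x, y, z₁, z₂, z₃⟩, -, h, hy, -⟩ := q
      simp only at h hy
      rw [mem_circle]
      simp only [Matrix.cons_val_zero, Matrix.cons_val_one]
      subst hy
      field_simp
      rw [ht3]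
      linear_combination 4 * h⟩
    invFun := fun p => ⟨(0, 0, r * (t * p.1 0 / 3 + p.1 1), r * (t * p.1 0 / 3 - p.1 1),
        -(2 * r * (t * p.1 0 / 3))), by
      have h := (mem_circle p.1).1 p.2
      refine ⟨by simp, ?_, rfl, by ring⟩
      linear_combination r ^ 2 * h + r ^ 2 * p.1 0 ^ 2 / 3 * ht3⟩
    left_inv := by
      rintro ⟨⟨x, y, z₁, z₂, z₃⟩, hx, -, hy, hz⟩
      simp only at hx hy hz
      subst hy
      have h0 : t * (t * (z₁ + z₂) / (2 * r)) / 3 = (z₁ + z₂) / (2 * r) := by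
        linear_combination (z₁ + z₂) / (2 * r) / 3 * ht3
      simp only [Subtype.mk.injEq, Prod.mk.injEq, Matrix.cons_val_zero,
        Matrix.cons_val_one, h0]
      refine ⟨by linarith, trivial, ?_, ?_, ?_⟩
      · field_simp
        ring
      · field_simp
        ring
      · field_simp
        linarith
    right_inv := by
      rintro ⟨p, hp⟩
      ext i
      fin_cases i
      · simp only [Fin.zero_eta, Matrix.cons_val_zero]
        field_simp
        linear_combination 2 * p 0 * ht3
      · simp only [Fin.mk_one, Matrix.cons_val_one, Matrix.cons_val_zero]
        field_simp
        ring
    continuous_toFun := by fun_prop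
    continuous_invFun := by fun_prop }⟩
end
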